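/- Let α = (φ,σ) be a minimal action of ℤ⋊ℤ₂ on a Cantor set X such that the ℤ-action induced by φ is not minimal, and let Y ⊆ X be a clopen set with Y ∩ σ(Y) = ∅, Y ∪ σ(Y) = X, φ(Y) = Y and φ|_Y minimal. Then H_0(ℤ⋊ℤ₂, C(X,ℤ)) ≅ H_0(ℤ, C(Y,ℤ)) (the coinvariants of C(Y,ℤ) under φ|_Y), H_1(ℤ⋊ℤ₂, C(X,ℤ)) ≅ ℤ, and H_n(ℤ⋊ℤ₂, C(X,ℤ)) = 0 for every n ≥ 2. -/

import Mathlib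

section GroupHomologyDef

variable (G M : Type*) [Group G] [AddCommGroup M] [DistribMulAction G M]

/-- The differential on inhomogeneous chains computing the homology of the group `G` with
coefficients in the `G`-module `M` (for the left action of `G` on `M`; a right module is
regarded as a left module by acting by inverses, which does not change homology). -/
noncomputable def inhomogeneousChainsD (n : ℕ) :
    ((Fin (n + 1) → G) →₀ M) →+ ((Fin n → G) →₀ M) :=
  Finsupp.liftAddHom fun g =>
    { toFun := fun m =>
        Finsupp.single (fun i => g i.succ) ((g 0)⁻¹ • m) +
          ∑ j : Fin (n + 1),
            (-1 : ℤ) ^ ((j : ℕ) + 1) • Finsupp.single (Fin.contractNth j (· * ·) g) m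
      map_zero' := by simp
      map_add' := fun a b => by
        simp only [smul_add, Finsupp.single_add, Finset.sum_add_distrib]
        abel }

/-- The subgroup of `n`-cycles of the complex of inhomogeneous chains. -/
noncomputable def homologyCycles : ∀ n : ℕ, AddSubgroup ((Fin n → G) →₀ M)
  | 0 => ⊤
  | (m + 1) => (inhomogeneousChainsD G M m).ker

/-- The `n`-th homology group `Hₙ(G, M)` of the group `G` with coefficients in the
`G`-module `M`: the quotient of the `n`-cycles by the `n`-boundaries of the complex of
inhomogeneous chains. -/
noncomputable def GroupHomology (n : ℕ) : Type _ :=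
  homologyCycles G M n ⧸
    ((inhomogeneousChainsD G M n).range.addSubgroupOf (homologyCycles G M n))

noncomputable instance (n : ℕ) : AddCommGroup (GroupHomology G M n) :=
  QuotientAddGroup.Quotient.addCommGroup _

end GroupHomologyDef

variable {X : Type*} [TopologicalSpace X]

/-- The subgroup `B = {h - h ∘ ψ : h ∈ C(Z, ℤ)}` of `C(Z, ℤ)`. -/
def coboundariesSubgroup {Z : Type*} [TopologicalSpace Z] (ψ : C(Z, Z)) :
    AddSubgroup C(Z, ℤ) :=
  (AddMonoidHom.mk' (fun h : C(Z, ℤ) => h - h.comp ψ)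
    (fun f g => by ext x; simp; ring)).range

/-- The restriction of `φ` to an invariant set `Y`, as a continuous self-map of `Y`. -/
def restrictCMap (φ : X ≃ₜ X) (Y : Set X) (h : φ '' Y = Y) : C(Y, Y) :=
  ⟨fun y => ⟨φ y, h.subset (Set.mem_image_of_mem _ y.2)⟩,
    Continuous.subtype_mk (φ.continuous.comp continuous_subtype_val) _⟩

section BarComplex

variable {G M M' N : Type*} [Group G] [AddCommGroup M] [DistribMulAction G M]
  [AddCommGroup M'] [DistribMulAction G M'] [AddCommGroup N]

lemma inhomogeneousChainsD_single (n : ℕ) (g : Fin (n + 1) → G) (m : M) :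
    inhomogeneousChainsD G M n (Finsupp.single g m) =
      Finsupp.single (fun i => g i.succ) ((g 0)⁻¹ • m) +
        ∑ j : Fin (n + 1),
          (-1 : ℤ) ^ ((j : ℕ) + 1) • Finsupp.single (Fin.contractNth j (· * ·) g) m := by
  simp [inhomogeneousChainsD]

/-- The differential is natural with respect to equivariant maps of coefficients. -/
lemma inhomogeneousChainsD_mapRange (f : M →+ M') (hf : ∀ (g : G) (m : M), f (g • m) = g • f m)
    (n : ℕ) (x : (Fin (n + 1) → G) →₀ M) :
    inhomogeneousChainsD G M' n (Finsupp.mapRange.addMonoidHom f x) =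
      Finsupp.mapRange.addMonoidHom f (inhomogeneousChainsD G M n x) := by
  induction x using Finsupp.induction_linear with
  | zero => simp
  | add x y hx hy => simp only [map_add, hx, hy]
  | single g m =>
    rw [inhomogeneousChainsD_single, map_add, map_sum]
    simp only [map_zsmul, Finsupp.mapRange.addMonoidHom_apply, Finsupp.mapRange_single]
    rw [inhomogeneousChainsD_single, hf]

lemma contractNth_zero_cons {n : ℕ} (a : G) (g : Fin (n + 1) → G) :
    Fin.contractNth 0 (· * ·) (Fin.cons a g : Fin (n + 2) → G) =
      Fin.cons (a * g 0) fun i => g i.succ := by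
  funext i
  refine Fin.cases ?_ (fun i => ?_) i <;> simp [Fin.contractNth]

lemma contractNth_succ_cons {n : ℕ} (a : G) (g : Fin (n + 1) → G) (j : Fin (n + 1)) :
    Fin.contractNth j.succ (· * ·) (Fin.cons a g : Fin (n + 2) → G) =
      Fin.cons a (Fin.contractNth j (· * ·) g) := by
  funext i
  refine Fin.cases ?_ (fun i => ?_) i <;> simp [Fin.contractNth]

attribute [local instance] Finsupp.comapDistribMulAction

lemma smul_single_regular (g h : G) (n : N) :
    g • (Finsupp.single h n : G →₀ N) = Finsupp.single (g * h) n := by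
  rw [Finsupp.comapSMul_single, smul_eq_mul]

/-- The contracting homotopy of the bar complex with coefficients in the `G`-module `N[G]`. -/
noncomputable def regularHomotopy (G N : Type*) [Group G] [AddCommGroup N] (n : ℕ) :
    ((Fin n → G) →₀ (G →₀ N)) →+ ((Fin (n + 1) → G) →₀ (G →₀ N)) :=
  Finsupp.liftAddHom fun g => Finsupp.liftAddHom fun h =>
    (Finsupp.singleAddHom (Fin.cons h⁻¹ g)).comp (Finsupp.singleAddHom 1)

lemma regularHomotopy_single (n : ℕ) (g : Fin n → G) (h : G) (a : N) :
    regularHomotopy G N n (Finsupp.single g (Finsupp.single h a)) =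
      Finsupp.single (Fin.cons h⁻¹ g) (Finsupp.single 1 a) := by
  rw [regularHomotopy, Finsupp.liftAddHom_apply_single, Finsupp.liftAddHom_apply_single]
  rfl

/-- The augmentation `N[G] → N`, on `0`-chains. -/
noncomputable def regularAugmentation (G N : Type*) [Group G] [AddCommGroup N] :
    ((Fin 0 → G) →₀ (G →₀ N)) →+ N :=
  Finsupp.liftAddHom fun _ => Finsupp.liftAddHom fun _ => AddMonoidHom.id N

lemma regularAugmentation_single (g : Fin 0 → G) (h : G) (a : N) :
    regularAugmentation G N (Finsupp.single g (Finsupp.single h a)) = a := by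
  rw [regularAugmentation, Finsupp.liftAddHom_apply_single, Finsupp.liftAddHom_apply_single]
  rfl

omit [Group G] in
lemma regularChains_addHom_ext {n : ℕ} {A : Type*} [AddCommGroup A]
    {f f' : ((Fin n → G) →₀ (G →₀ N)) →+ A}
    (H : ∀ g h a, f (Finsupp.single g (Finsupp.single h a)) =
      f' (Finsupp.single g (Finsupp.single h a))) : f = f' := by
  refine Finsupp.addHom_ext' fun g => Finsupp.addHom_ext' fun h => AddMonoidHom.ext fun a => ?_
  exact H g h a

lemma inhomogeneousChainsD_regularHomotopy_succ (n : ℕ) (x : (Fin (n + 1) → G) →₀ (G →₀ N)) :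
    inhomogeneousChainsD G (G →₀ N) (n + 1) (regularHomotopy G N (n + 1) x) =
      x - regularHomotopy G N n (inhomogeneousChainsD G (G →₀ N) n x) := by
  suffices h : (inhomogeneousChainsD G (G →₀ N) (n + 1)).comp (regularHomotopy G N (n + 1)) =
      AddMonoidHom.id _ - (regularHomotopy G N n).comp (inhomogeneousChainsD G (G →₀ N) n) from
    DFunLike.congr_fun h x
  refine regularChains_addHom_ext fun g h a => ?_
  simp only [AddMonoidHom.comp_apply, AddMonoidHom.sub_apply, AddMonoidHom.id_apply,
    regularHomotopy_single, inhomogeneousChainsD_single, Fin.sum_univ_succ (n := n + 1),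
    contractNth_zero_cons, contractNth_succ_cons, map_add, map_sum, map_zsmul,
    smul_single_regular, Fin.cons_succ, Fin.cons_zero]
  simp [pow_succ]
  abel

lemma inhomogeneousChainsD_regularHomotopy_zero (x : (Fin 0 → G) →₀ (G →₀ N)) :
    inhomogeneousChainsD G (G →₀ N) 0 (regularHomotopy G N 0 x) =
      x - Finsupp.single default (Finsupp.single 1 (regularAugmentation G N x)) := by
  suffices h : (inhomogeneousChainsD G (G →₀ N) 0).comp (regularHomotopy G N 0) =
      AddMonoidHom.id _ - ((Finsupp.singleAddHom default).comp (Finsupp.singleAddHom 1)).comp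
        (regularAugmentation G N) from
    DFunLike.congr_fun h x
  refine regularChains_addHom_ext fun g h a => ?_
  simp [regularHomotopy_single, inhomogeneousChainsD_single, regularAugmentation_single,
    sub_eq_add_neg, Subsingleton.elim g default,
    Subsingleton.elim (Fin.contractNth _ _ _) (default : Fin 0 → G)]

lemma regularAugmentation_inhomogeneousChainsD (x : (Fin 1 → G) →₀ (G →₀ N)) :
    regularAugmentation G N (inhomogeneousChainsD G (G →₀ N) 0 x) = 0 := by
  suffices h : (regularAugmentation G N).comp (inhomogeneousChainsD G (G →₀ N) 0) = 0 from
    DFunLike.congr_fun h x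
  refine regularChains_addHom_ext fun g h a => ?_
  simp [inhomogeneousChainsD_single, regularAugmentation_single]

lemma exists_regular_of_augmentation_eq_zero (x : (Fin 0 → G) →₀ (G →₀ N))
    (hx : regularAugmentation G N x = 0) :
    ∃ y, inhomogeneousChainsD G (G →₀ N) 0 y = x :=
  ⟨regularHomotopy G N 0 x, by simp [inhomogeneousChainsD_regularHomotopy_zero, hx]⟩

lemma exists_regular_of_cycle (n : ℕ) (x : (Fin (n + 1) → G) →₀ (G →₀ N))
    (hx : inhomogeneousChainsD G (G →₀ N) n x = 0) :
    ∃ y, inhomogeneousChainsD G (G →₀ N) (n + 1) y = x :=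
  ⟨regularHomotopy G N (n + 1) x, by simp [inhomogeneousChainsD_regularHomotopy_succ, hx]⟩

/-- Right translation by `k` on `N[G]`. -/
noncomputable def rightTranslation (N : Type*) [AddCommGroup N] (k : G) : (G →₀ N) →+ (G →₀ N) :=
  Finsupp.mapDomain.addMonoidHom (· * k)

lemma rightTranslation_smul (k g : G) (p : G →₀ N) :
    rightTranslation N k (g • p) = g • rightTranslation N k p := by
  induction p using Finsupp.induction_linear with
  | zero => simp
  | add x y hx hy => simp only [smul_add, map_add, hx, hy]
  | single h a => simp [rightTranslation, Finsupp.mapDomain_single, mul_assoc]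

lemma inhomogeneousChainsD_regular_comp (n : ℕ) (x : (Fin (n + 2) → G) →₀ (G →₀ N)) :
    inhomogeneousChainsD G (G →₀ N) n (inhomogeneousChainsD G (G →₀ N) (n + 1) x) = 0 := by
  have key : ∀ y, inhomogeneousChainsD G (G →₀ N) n
      (inhomogeneousChainsD G (G →₀ N) (n + 1) (regularHomotopy G N (n + 1) y)) = 0 →
      ∀ k, inhomogeneousChainsD G (G →₀ N) n (inhomogeneousChainsD G (G →₀ N) (n + 1)
      (Finsupp.mapRange.addMonoidHom (rightTranslation N k) (regularHomotopy G N (n + 1) y))) =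
        0 := by
    intro y hy k
    rw [inhomogeneousChainsD_mapRange _ (rightTranslation_smul k),
      inhomogeneousChainsD_mapRange _ (rightTranslation_smul k), hy, map_zero]
  suffices h : (inhomogeneousChainsD G (G →₀ N) n).comp (inhomogeneousChainsD G (G →₀ N) (n + 1)) =
      0 from DFunLike.congr_fun h x
  refine regularChains_addHom_ext fun g h a => ?_
  have := key (Finsupp.single (fun i => g i.succ) (Finsupp.single (g 0)⁻¹ a)) ?_ h
  · simpa [regularHomotopy_single, rightTranslation, Finsupp.mapDomain_single,
      show (Fin.cons (g 0) fun i => g i.succ : Fin (n + 2) → G) = g from Fin.cons_self_tail g]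
      using this
  rw [inhomogeneousChainsD_regularHomotopy_succ, map_sub]
  cases n with
  | zero =>
    simp [inhomogeneousChainsD_regularHomotopy_zero, regularAugmentation_inhomogeneousChainsD]
  | succ n =>
    simp [inhomogeneousChainsD_regularHomotopy_succ, inhomogeneousChainsD_regular_comp n]

section Resolution

variable (T : N ≃+ N) (r : G)

/-- The map `h n ↦ h n - (h r) (T n)` on `N[G]`. -/
noncomputable def twistedDifference : (G →₀ N) →+ (G →₀ N) :=
  Finsupp.liftAddHom fun h =>
    Finsupp.singleAddHom h - (Finsupp.singleAddHom (h * r)).comp T.toAddMonoidHom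

lemma twistedDifference_single (h : G) (a : N) :
    twistedDifference T r (Finsupp.single h a) =
      Finsupp.single h a - Finsupp.single (h * r) (T a) := by
  rw [twistedDifference, Finsupp.liftAddHom_apply_single]
  rfl

lemma twistedDifference_smul (g : G) (p : G →₀ N) :
    twistedDifference T r (g • p) = g • twistedDifference T r p := by
  induction p using Finsupp.induction_linear with
  | zero => simp
  | add x y hx hy => simp only [smul_add, map_add, hx, hy]
  | single h a => simp [twistedDifference_single, smul_sub, mul_assoc]

lemma twistedDifference_apply (p : G →₀ N) (g : G) :
    twistedDifference T r p g = p g - T (p (g * r⁻¹)) := by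
  classical
  induction p using Finsupp.induction_linear with
  | zero => simp
  | add x y hx hy => simp only [map_add, Finsupp.add_apply, hx, hy]; abel
  | single h a =>
    simp only [twistedDifference_single, Finsupp.sub_apply, Finsupp.single_apply,
      eq_mul_inv_iff_mul_eq]
    split_ifs <;> simp

lemma twistedDifference_injective (hr : ∀ k : ℕ, r ^ k = 1 → k = 0) :
    Function.Injective (twistedDifference T r) := by
  rw [injective_iff_map_eq_zero]
  intro p hp
  have h1 : ∀ g, p g = T (p (g * r⁻¹)) := fun g => by
    have := twistedDifference_apply T r p g
    rw [hp, Finsupp.coe_zero, Pi.zero_apply] at this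
    exact (sub_eq_zero.1 this.symm)
  ext g
  by_contra hg
  have h2 : ∀ k : ℕ, p (g * r⁻¹ ^ k) ≠ 0 := by
    intro k
    induction k with
    | zero => simpa using hg
    | succ k ih =>
      intro h
      rw [pow_succ, ← mul_assoc] at h
      exact ih (by rw [h1, h, map_zero])
  have hinj : Function.Injective fun k : ℕ => g * r⁻¹ ^ k := by
    have hfin : ¬ IsOfFinOrder r := fun h => by
      obtain ⟨n, hn, hn'⟩ := isOfFinOrder_iff_pow_eq_one.1 h
      exact hn.ne' (hr n hn')
    exact (mul_right_injective g).comp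
      (injective_pow_iff_not_isOfFinOrder.2 fun h => hfin (isOfFinOrder_inv_iff.1 h))
  exact Set.infinite_range_of_injective hinj
    (p.support.finite_toSet.subset (by rintro _ ⟨k, rfl⟩; simpa using h2 k))

lemma regularAugmentation_twistedDifference (x : (Fin 0 → G) →₀ (G →₀ N)) :
    regularAugmentation G N (Finsupp.mapRange.addMonoidHom (twistedDifference T r) x) =
      regularAugmentation G N x - T (regularAugmentation G N x) := by
  suffices h : (regularAugmentation G N).comp
      (Finsupp.mapRange.addMonoidHom (twistedDifference T r)) =
      regularAugmentation G N - T.toAddMonoidHom.comp (regularAugmentation G N) from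
    DFunLike.congr_fun h x
  refine regularChains_addHom_ext fun g h a => ?_
  simp [twistedDifference_single, regularAugmentation_single, Finsupp.single_sub]

/-- Modulo twisted differences, `single (h * r ^ k) a` is congruent to some `single h b`. -/
lemma single_mul_zpow_sub_mem_range (h : G) (k : ℤ) (a : N) :
    ∃ b, Finsupp.single (h * r ^ k) a - Finsupp.single h b ∈ (twistedDifference T r).range := by
  induction k using Int.induction_on generalizing a with
  | zero => exact ⟨a, by simp⟩
  | succ k ih =>
    obtain ⟨b, hb⟩ := ih (T.symm a)
    refine ⟨b, ?_⟩
    have h1 : twistedDifference T r (Finsupp.single (h * r ^ (k : ℤ)) (T.symm a)) ∈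
      (twistedDifference T r).range := ⟨_, rfl⟩
    rw [twistedDifference_single, mul_assoc, ← zpow_add_one, T.apply_symm_apply] at h1
    have := sub_mem hb h1
    rwa [sub_sub_sub_cancel_left] at this
  | pred k ih =>
    obtain ⟨b, hb⟩ := ih (T a)
    refine ⟨b, ?_⟩
    have h1 : twistedDifference T r (Finsupp.single (h * r ^ (-(k : ℤ) - 1)) a) ∈
      (twistedDifference T r).range := ⟨_, rfl⟩
    rw [twistedDifference_single, mul_assoc, ← zpow_add_one, sub_add_cancel] at h1
    have := add_mem h1 hb
    rwa [sub_add_sub_cancel] at this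

end Resolution

omit [Group G] [DistribMulAction G M] [DistribMulAction G M'] in
/-- Chains with values in the range of `f` come from chains of the source. -/
lemma exists_mapRange_eq {α : Type*} (f : M →+ M') (x : α →₀ M') (hx : ∀ i, x i ∈ f.range) :
    ∃ y, Finsupp.mapRange.addMonoidHom f y = x := by
  suffices h : x ∈ (Finsupp.mapRange.addMonoidHom (ι := α) f).range from h
  rw [← Finsupp.sum_single x]
  refine sum_mem fun i _ => ?_
  obtain ⟨m, hm⟩ := hx i
  exact ⟨Finsupp.single i m, by simp [hm]⟩

omit [Group G] [DistribMulAction G M] [DistribMulAction G M'] in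
lemma exists_mapRange_eq_of_exact {α M'' : Type*} [AddCommGroup M''] (f : M →+ M') (f' : M' →+ M'')
    (hf : ∀ m, f' m = 0 → m ∈ f.range) (x : α →₀ M')
    (hx : Finsupp.mapRange.addMonoidHom f' x = 0) :
    ∃ y, Finsupp.mapRange.addMonoidHom f y = x :=
  exists_mapRange_eq f x fun i => hf _ (by simpa using DFunLike.congr_fun hx i)

/-- A `G`-module `M` which is induced from the infinite cyclic subgroup generated by `r`, of index
two with other coset represented by the involution `s`; the inducing module is `N`, on which
`r⁻¹` acts by `T`. -/
structure IsDihedralInduced (r s : G) (T : N ≃+ N) (ι : N →+ M) (ρ : M →+ N) : Prop where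
  mul_self : s * s = 1
  pow_eq_one : ∀ k : ℕ, r ^ k = 1 → k = 0
  exists_zpow : ∀ g : G, (∃ k : ℤ, g = r ^ k) ∨ ∃ k : ℤ, g = s * r ^ k
  twist : ∀ n, ι (T n) = r⁻¹ • ι n
  proj_incl : ∀ n, ρ (ι n) = n
  proj_smul_incl : ∀ n, ρ (s • ι n) = 0
  decomp : ∀ m, m = ι (ρ m) + s • ι (ρ (s • m))

namespace IsDihedralInduced

variable {r s : G} {T : N ≃+ N} {ι : N →+ M} {ρ : M →+ N}

/-- The equivariant map `N[G] → M` extending `ι`. -/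
noncomputable def cover (G : Type*) [Group G] [DistribMulAction G M] (ι : N →+ M) :
    (G →₀ N) →+ M :=
  Finsupp.liftAddHom fun h => (DistribSMul.toAddMonoidHom M h).comp ι

lemma cover_single (h : G) (a : N) : cover G ι (Finsupp.single h a) = h • ι a := by
  rw [cover, Finsupp.liftAddHom_apply_single]
  rfl

lemma cover_smul (g : G) (p : G →₀ N) : cover G ι (g • p) = g • cover G ι p := by
  induction p using Finsupp.induction_linear with
  | zero => simp
  | add x y hx hy => simp only [smul_add, map_add, hx, hy]
  | single h a => simp [cover_single, mul_smul]

/-- The additive section of `cover`. -/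
noncomputable def coverSection (s : G) (ρ : M →+ N) : M →+ (G →₀ N) :=
  (Finsupp.singleAddHom 1).comp ρ +
    (Finsupp.singleAddHom s).comp (ρ.comp (DistribSMul.toAddMonoidHom M s))

lemma coverSection_apply (m : M) :
    coverSection s ρ m = Finsupp.single 1 (ρ m) + Finsupp.single s (ρ (s • m)) := rfl

variable (H : IsDihedralInduced r s T ι ρ)
include H

lemma cover_coverSection (m : M) : cover G ι (coverSection s ρ m) = m := by
  rw [coverSection_apply, map_add, cover_single, cover_single, one_smul, ← H.decomp]

lemma cover_twistedDifference (p : G →₀ N) : cover G ι (twistedDifference T r p) = 0 := by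
  induction p using Finsupp.induction_linear with
  | zero => simp
  | add x y hx hy => simp only [map_add, hx, hy, add_zero]
  | single h a => simp [twistedDifference_single, cover_single, H.twist, mul_smul]

lemma sub_coverSection_mem_range (p : G →₀ N) :
    p - coverSection s ρ (cover G ι p) ∈ (twistedDifference T r).range := by
  induction p using Finsupp.induction_linear with
  | zero => simp
  | add x y hx hy =>
    have := add_mem hx hy
    rwa [sub_add_sub_comm, ← map_add, ← map_add] at this
  | single h a =>
    have key : ∀ q q' : G →₀ N, q - q' ∈ (twistedDifference T r).range →
        coverSection s ρ (cover G ι q') = q' →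
        q - coverSection s ρ (cover G ι q) ∈ (twistedDifference T r).range := by
      intro q q' hq hq'
      have : cover G ι q = cover G ι q' := by
        obtain ⟨y, hy⟩ := hq
        rw [← sub_eq_zero, ← map_sub, ← hy, H.cover_twistedDifference]
      rwa [this, hq']
    rcases H.exists_zpow h with ⟨k, rfl⟩ | ⟨k, rfl⟩
    · obtain ⟨b, hb⟩ := single_mul_zpow_sub_mem_range T r 1 k a
      rw [one_mul] at hb
      refine key _ _ hb ?_
      simp [cover_single, coverSection_apply, H.proj_incl, H.proj_smul_incl]
    · obtain ⟨b, hb⟩ := single_mul_zpow_sub_mem_range T r s k a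
      refine key _ _ hb ?_
      simp [cover_single, coverSection_apply, H.proj_incl, H.proj_smul_incl, ← mul_smul,
        H.mul_self]

lemma mem_range_of_cover_eq_zero (p : G →₀ N) (hp : cover G ι p = 0) :
    p ∈ (twistedDifference T r).range := by
  simpa [hp] using H.sub_coverSection_mem_range p

lemma exists_lift {n : ℕ} (x : (Fin n → G) →₀ M) :
    ∃ y, Finsupp.mapRange.addMonoidHom (cover G ι) y = x :=
  exists_mapRange_eq _ x fun _ => ⟨_, H.cover_coverSection _⟩

lemma exists_twistedDifference {n : ℕ} (x : (Fin n → G) →₀ (G →₀ N))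
    (hx : Finsupp.mapRange.addMonoidHom (cover G ι) x = 0) :
    ∃ y, Finsupp.mapRange.addMonoidHom (twistedDifference T r) y = x :=
  exists_mapRange_eq_of_exact _ _ H.mem_range_of_cover_eq_zero x hx

lemma mapRange_cover_twistedDifference {n : ℕ} (x : (Fin n → G) →₀ (G →₀ N)) :
    Finsupp.mapRange.addMonoidHom (cover G ι)
      (Finsupp.mapRange.addMonoidHom (twistedDifference T r) x) = 0 := by
  ext i
  simpa using H.cover_twistedDifference (x i)

lemma mapRange_twistedDifference_injective {n : ℕ} : Function.Injective
    (Finsupp.mapRange.addMonoidHom (ι := Fin n → G) (twistedDifference T r)) :=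
  Finsupp.mapRange_injective _ (map_zero _) (twistedDifference_injective T r H.pow_eq_one)

/-- Cycles of degree at least two are boundaries. -/
lemma exists_boundary (n : ℕ) (x : (Fin (n + 2) → G) →₀ M)
    (hx : inhomogeneousChainsD G M (n + 1) x = 0) :
    ∃ w, inhomogeneousChainsD G M (n + 2) w = x := by
  obtain ⟨x, rfl⟩ := H.exists_lift x
  rw [inhomogeneousChainsD_mapRange _ cover_smul] at hx
  obtain ⟨y, hy⟩ := H.exists_twistedDifference _ hx
  obtain ⟨z, rfl⟩ := exists_regular_of_cycle n y (H.mapRange_twistedDifference_injective (by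
    rw [← inhomogeneousChainsD_mapRange _ (twistedDifference_smul T r), hy,
      inhomogeneousChainsD_regular_comp, map_zero]))
  rw [← inhomogeneousChainsD_mapRange _ (twistedDifference_smul T r), ← sub_eq_zero, ← map_sub]
    at hy
  obtain ⟨w, hw⟩ := exists_regular_of_cycle (n + 1) _ hy
  refine ⟨-Finsupp.mapRange.addMonoidHom (cover G ι) w, ?_⟩
  rw [map_neg, inhomogeneousChainsD_mapRange _ cover_smul, hw, map_sub,
    H.mapRange_cover_twistedDifference, zero_sub, neg_neg]

lemma inhomogeneousChainsD_single_incl {n : N} (hn : T n = n) :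
    inhomogeneousChainsD G M 0 (Finsupp.single (fun _ => r) (ι n)) = 0 := by
  rw [inhomogeneousChainsD_single]
  simp [← H.twist, hn, Subsingleton.elim (Fin.contractNth _ _ _) (default : Fin 0 → G),
    Subsingleton.elim (fun _ => r) (default : Fin 0 → G)]

omit H in
lemma twistedDifference_single_inv {n : N} (hn : T n = n) :
    Finsupp.mapRange.addMonoidHom (twistedDifference T r)
      (Finsupp.single default (Finsupp.single r⁻¹ n)) =
    inhomogeneousChainsD G (G →₀ N) 0 (Finsupp.single (fun _ => r) (Finsupp.single 1 n)) := by
  rw [inhomogeneousChainsD_single]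
  simp [twistedDifference_single, hn, sub_eq_add_neg, Finsupp.single_add,
    Subsingleton.elim (Fin.contractNth _ _ _) (default : Fin 0 → G),
    Subsingleton.elim (fun _ => r) (default : Fin 0 → G)]

/-- Every one-cycle is homologous to one of the form `single r (ι n)` with `n` invariant. -/
lemma exists_invariant (x : (Fin 1 → G) →₀ M) (hx : inhomogeneousChainsD G M 0 x = 0) :
    ∃ n, T n = n ∧ ∃ w, inhomogeneousChainsD G M 1 w =
      x - Finsupp.single (fun _ => r) (ι n) := by
  obtain ⟨x, rfl⟩ := H.exists_lift x
  rw [inhomogeneousChainsD_mapRange _ cover_smul] at hx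
  obtain ⟨y, hy⟩ := H.exists_twistedDifference _ hx
  have hn : T (regularAugmentation G N y) = regularAugmentation G N y := by
    have := regularAugmentation_twistedDifference T r y
    rw [hy, regularAugmentation_inhomogeneousChainsD] at this
    exact (sub_eq_zero.1 this.symm).symm
  refine ⟨_, hn, ?_⟩
  have h1 := twistedDifference_single_inv (G := G) (r := r) hn
  set n := regularAugmentation G N y
  obtain ⟨z, hz⟩ := exists_regular_of_augmentation_eq_zero
    (y - Finsupp.single default (Finsupp.single r⁻¹ n))
    (by rw [map_sub, regularAugmentation_single, sub_self])
  obtain ⟨w, hw⟩ := exists_regular_of_cycle 0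
    (x - Finsupp.single (fun _ => r) (Finsupp.single 1 n) -
      Finsupp.mapRange.addMonoidHom (twistedDifference T r) z) (by
    rw [map_sub, map_sub, inhomogeneousChainsD_mapRange _ (twistedDifference_smul T r), hz,
      map_sub, hy, h1, sub_self])
  refine ⟨Finsupp.mapRange.addMonoidHom (cover G ι) w, ?_⟩
  rw [inhomogeneousChainsD_mapRange _ cover_smul, hw, map_sub,
    H.mapRange_cover_twistedDifference, sub_zero, map_sub]
  simp [cover_single]

lemma eq_zero_of_boundary {n : N} (hn : T n = n) (w : (Fin 2 → G) →₀ M)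
    (hw : inhomogeneousChainsD G M 1 w = Finsupp.single (fun _ => r) (ι n)) : n = 0 := by
  obtain ⟨w, rfl⟩ := H.exists_lift w
  rw [inhomogeneousChainsD_mapRange _ cover_smul] at hw
  obtain ⟨v, hv⟩ := H.exists_twistedDifference (inhomogeneousChainsD G (G →₀ N) 1 w -
    Finsupp.single (fun _ => r) (Finsupp.single 1 n)) (by
      rw [map_sub, hw]
      simp [cover_single])
  have h1 := congrArg (inhomogeneousChainsD G (G →₀ N) 0) hv
  rw [inhomogeneousChainsD_mapRange _ (twistedDifference_smul T r), map_sub,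
    inhomogeneousChainsD_regular_comp, zero_sub, ← twistedDifference_single_inv hn,
    ← map_neg] at h1
  have h2 := congrArg (regularAugmentation G N) (H.mapRange_twistedDifference_injective h1)
  rw [regularAugmentation_inhomogeneousChainsD, map_neg, regularAugmentation_single] at h2
  exact neg_eq_zero.1 h2.symm

/-- The map inducing the isomorphism of `H₀(G, M)` with the coinvariants of `N`. -/
noncomputable def zeroChainsToQuotient (s : G) (ρ : M →+ N) (R : AddSubgroup N) :
    ((Fin 0 → G) →₀ M) →+ N ⧸ R :=
  (QuotientAddGroup.mk' R).comp
    ((regularAugmentation G N).comp (Finsupp.mapRange.addMonoidHom (coverSection s ρ)))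

lemma zeroChainsToQuotient_cover {R : AddSubgroup N} (hR : ∀ n, n ∈ R ↔ ∃ h, h - T h = n)
    (x : (Fin 0 → G) →₀ (G →₀ N)) :
    zeroChainsToQuotient s ρ R (Finsupp.mapRange.addMonoidHom (cover G ι) x) =
      QuotientAddGroup.mk' R (regularAugmentation G N x) := by
  obtain ⟨y, hy⟩ := H.exists_twistedDifference
    (x - Finsupp.mapRange.addMonoidHom (coverSection s ρ)
      (Finsupp.mapRange.addMonoidHom (cover G ι) x)) (by
    ext
    simp [H.cover_coverSection])
  have h := regularAugmentation_twistedDifference T r y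
  rw [hy, map_sub] at h
  refine (sub_eq_zero.1 ?_).symm
  rw [zeroChainsToQuotient, AddMonoidHom.comp_apply, AddMonoidHom.comp_apply, ← map_sub, h]
  exact (QuotientAddGroup.eq_zero_iff _).2 ((hR _).2 ⟨_, rfl⟩)

lemma zeroChainsToQuotient_surjective {R : AddSubgroup N}
    (hR : ∀ n, n ∈ R ↔ ∃ h, h - T h = n) :
    Function.Surjective (zeroChainsToQuotient (G := G) s ρ R) := by
  intro q
  obtain ⟨n, rfl⟩ := QuotientAddGroup.mk'_surjective R q
  refine ⟨_, (H.zeroChainsToQuotient_cover hR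
    (Finsupp.single default (Finsupp.single 1 n))).trans ?_⟩
  rw [regularAugmentation_single]

lemma zeroChainsToQuotient_eq_zero_iff {R : AddSubgroup N}
    (hR : ∀ n, n ∈ R ↔ ∃ h, h - T h = n) (x : (Fin 0 → G) →₀ M) :
    zeroChainsToQuotient s ρ R x = 0 ↔ x ∈ (inhomogeneousChainsD G M 0).range := by
  constructor
  · intro hx
    obtain ⟨x, rfl⟩ := H.exists_lift x
    rw [H.zeroChainsToQuotient_cover hR] at hx
    obtain ⟨h, hh⟩ := (hR _).1 ((QuotientAddGroup.eq_zero_iff _).1 hx)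
    obtain ⟨z, hz⟩ := exists_regular_of_augmentation_eq_zero
      (x - Finsupp.mapRange.addMonoidHom (twistedDifference T r)
        (Finsupp.single default (Finsupp.single 1 h))) (by
      rw [map_sub, regularAugmentation_twistedDifference, regularAugmentation_single, hh,
        sub_self])
    refine ⟨Finsupp.mapRange.addMonoidHom (cover G ι) z, ?_⟩
    rw [inhomogeneousChainsD_mapRange _ cover_smul, hz, map_sub,
      H.mapRange_cover_twistedDifference, sub_zero]
  · rintro ⟨w, rfl⟩
    obtain ⟨w, rfl⟩ := H.exists_lift w
    rw [inhomogeneousChainsD_mapRange _ cover_smul, H.zeroChainsToQuotient_cover hR,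
      regularAugmentation_inhomogeneousChainsD, map_zero]

/-- `H₀(G, M)` is the group of coinvariants of `N`. -/
theorem nonempty_groupHomology_zero_equiv {R : AddSubgroup N}
    (hR : ∀ n, n ∈ R ↔ ∃ h, h - T h = n) :
    Nonempty (GroupHomology G M 0 ≃+ N ⧸ R) := by
  have hsurj : Function.Surjective
      ((zeroChainsToQuotient (G := G) s ρ R).comp (homologyCycles G M 0).subtype) := fun q => by
    obtain ⟨x, hx⟩ := H.zeroChainsToQuotient_surjective hR q
    exact ⟨⟨x, AddSubgroup.mem_top x⟩, hx⟩
  have hker : (inhomogeneousChainsD G M 0).range.addSubgroupOf (homologyCycles G M 0) =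
      ((zeroChainsToQuotient (G := G) s ρ R).comp (homologyCycles G M 0).subtype).ker := by
    ext x
    exact (H.zeroChainsToQuotient_eq_zero_iff hR x).symm
  exact ⟨(QuotientAddGroup.quotientAddEquivOfEq hker).trans
    (QuotientAddGroup.quotientKerEquivOfSurjective _ hsurj)⟩

/-- `H₁(G, M)` is the group of invariants of `N`. -/
theorem nonempty_groupHomology_one_equiv :
    Nonempty (GroupHomology G M 1 ≃+ (T.toAddMonoidHom - AddMonoidHom.id N).ker) := by
  have hinv : ∀ n : (T.toAddMonoidHom - AddMonoidHom.id N).ker, T n = n := fun n =>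
    sub_eq_zero.1 n.2
  let c : (T.toAddMonoidHom - AddMonoidHom.id N).ker →+ homologyCycles G M 1 :=
    ((Finsupp.singleAddHom fun _ => r).comp
      (ι.comp (T.toAddMonoidHom - AddMonoidHom.id N).ker.subtype)).codRestrict _
      fun n => H.inhomogeneousChainsD_single_incl (hinv n)
  let f : (T.toAddMonoidHom - AddMonoidHom.id N).ker →+ GroupHomology G M 1 :=
    (QuotientAddGroup.mk' _).comp c
  have hf : Function.Bijective f := by
    constructor
    · rw [injective_iff_map_eq_zero]
      intro n hn
      obtain ⟨w, hw⟩ := (QuotientAddGroup.eq_zero_iff _).1 hn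
      exact Subtype.ext (H.eq_zero_of_boundary (hinv n) w hw)
    · intro q
      obtain ⟨⟨x, hx⟩, rfl⟩ := QuotientAddGroup.mk'_surjective _ q
      obtain ⟨n, hn, w, hw⟩ := H.exists_invariant x hx
      refine ⟨⟨n, sub_eq_zero.2 hn⟩, QuotientAddGroup.eq.2 ⟨w, ?_⟩⟩
      rw [hw, sub_eq_neg_add]
      rfl
  exact ⟨(AddEquiv.ofBijective f hf).symm⟩

/-- The homology groups `Hₙ(G, M)` vanish for `n ≥ 2`. -/
theorem groupHomology_eq_zero (n : ℕ) (hn : 2 ≤ n) (x : GroupHomology G M n) : x = 0 := by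
  obtain ⟨n, rfl⟩ := Nat.exists_eq_add_of_le' hn
  obtain ⟨⟨x, hx⟩, rfl⟩ := QuotientAddGroup.mk'_surjective _ x
  exact (QuotientAddGroup.eq_zero_iff _).2 (H.exists_boundary n x hx)

end IsDihedralInduced

end BarComplex

section DihedralSystem

/-- Extension by zero of continuous functions from a clopen set. -/
noncomputable def extendByZero (Y : Set X) (hY : IsClopen Y) : C(Y, ℤ) →+ C(X, ℤ) where
  toFun n := ⟨Function.extend Subtype.val n 0, by
    refine IsLocallyConstant.continuous ((IsLocallyConstant.iff_exists_open _).2 fun x => ?_)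
    by_cases hx : x ∈ Y
    · refine ⟨Subtype.val '' (n ⁻¹' {n ⟨x, hx⟩}),
        hY.isOpen.isOpenMap_subtype_val _ ((isOpen_discrete _).preimage n.continuous),
        ⟨⟨x, hx⟩, rfl, rfl⟩, ?_⟩
      rintro _ ⟨y, hy, rfl⟩
      rw [Subtype.val_injective.extend_apply]
      exact hy.trans (Subtype.val_injective.extend_apply n 0 ⟨x, hx⟩).symm
    · refine ⟨Yᶜ, hY.compl.isOpen, hx, fun y hy => ?_⟩
      rw [Function.extend_apply' _ _ _ (by simpa using hy),
        Function.extend_apply' _ _ _ (by simpa using hx)]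
      rfl⟩
  map_zero' := by
    ext x
    by_cases hx : ∃ y : Y, y.1 = x
    · obtain ⟨y, rfl⟩ := hx
      exact Subtype.val_injective.extend_apply _ _ _
    · exact Function.extend_apply' _ _ _ hx
  map_add' n m := by
    ext x
    by_cases hx : ∃ y : Y, y.1 = x
    · obtain ⟨y, rfl⟩ := hx
      simp
    · simp [Function.extend_apply' _ _ _ hx]

lemma extendByZero_apply_mem {Y : Set X} (hY : IsClopen Y) (n : C(Y, ℤ)) (y : Y) :
    extendByZero Y hY n y = n y :=
  Subtype.val_injective.extend_apply n 0 y

lemma extendByZero_apply_notMem {Y : Set X} (hY : IsClopen Y) (n : C(Y, ℤ)) {x : X}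
    (hx : x ∉ Y) : extendByZero Y hY n x = 0 :=
  Function.extend_apply' n (0 : X → ℤ) x fun ⟨y, hy⟩ => hx (hy ▸ y.2)

/-- Restriction of continuous functions to a subset. -/
def restrictToSet (Y : Set X) : C(X, ℤ) →+ C(Y, ℤ) where
  toFun f := f.restrict Y
  map_zero' := rfl
  map_add' _ _ := rfl

/-- Composition with the homeomorphism induced by `φ` on an invariant set. -/
def restrictCompEquiv (φ : X ≃ₜ X) (Y : Set X) (h : φ '' Y = Y) : C(Y, ℤ) ≃+ C(Y, ℤ) where
  toFun n := n.comp (restrictCMap φ Y h)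
  invFun n := n.comp (restrictCMap φ.symm Y (by
    rw [Homeomorph.image_symm]
    nth_rewrite 1 [← h]
    exact φ.injective.preimage_image Y))
  left_inv n := by
    ext y
    exact congrArg n (Subtype.ext (φ.apply_symm_apply y))
  right_inv n := by
    ext y
    exact congrArg n (Subtype.ext (φ.symm_apply_apply y))
  map_add' _ _ := rfl

lemma mem_coboundariesSubgroup_iff {Z : Type*} [TopologicalSpace Z] (ψ : C(Z, Z)) (n : C(Z, ℤ)) :
    n ∈ coboundariesSubgroup ψ ↔ ∃ h : C(Z, ℤ), h - h.comp ψ = n :=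
  Iff.rfl

lemma mem_iff_of_image_eq {φ : X ≃ₜ X} {Y : Set X} (h : φ '' Y = Y) (x : X) : φ x ∈ Y ↔ x ∈ Y := by
  nth_rewrite 1 [← h]
  exact φ.injective.mem_set_image

lemma mem_iff_apply_notMem {σ : X ≃ₜ X} {Y : Set X} (hσ : ∀ x, σ (σ x) = x)
    (hYσ : Y ∩ σ '' Y = ∅) (hYcov : Y ∪ σ '' Y = Set.univ) (x : X) : x ∈ Y ↔ σ x ∉ Y := by
  have hmem : ∀ z, z ∈ σ '' Y ↔ σ z ∈ Y := fun z =>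
    ⟨fun ⟨y, hy, hyz⟩ => by rwa [← hyz, hσ], fun hz => ⟨σ z, hz, hσ z⟩⟩
  constructor
  · intro hx hx'
    exact Set.notMem_empty x (hYσ ▸ ⟨hx, (hmem x).2 hx'⟩)
  · intro hx
    rcases (hYcov ▸ Set.mem_univ x : x ∈ Y ∪ σ '' Y) with h | h
    · exact h
    · exact absurd ((hmem x).1 h) hx

lemma dihedralGroup_r_eq_zpow (k : ℤ) :
    (DihedralGroup.r k : DihedralGroup 0) = DihedralGroup.r 1 ^ k := by
  rw [DihedralGroup.r_one_zpow]
  exact congrArg DihedralGroup.r (Int.cast_id (n := k)).symm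

/-- If `X` is the disjoint union of a clopen `φ`-invariant set `Y` and of `σ '' Y`, then the module
`C(X, ℤ)` is induced from `C(Y, ℤ)`. -/
theorem isDihedralInduced_of_clopen (φ σ : X ≃ₜ X) (hσ : ∀ x, σ (σ x) = x)
    (Y : Set X) (hY : IsClopen Y) (hYσ : Y ∩ σ '' Y = ∅) (hYcov : Y ∪ σ '' Y = Set.univ)
    (hYφ : φ '' Y = Y) [DistribMulAction (DihedralGroup 0) C(X, ℤ)]
    (hr : ∀ f : C(X, ℤ),
      (DihedralGroup.r 1 : DihedralGroup 0) • f = f.comp (φ.symm : C(X, X)))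
    (hsr : ∀ f : C(X, ℤ),
      (DihedralGroup.sr 0 : DihedralGroup 0) • f = f.comp (σ : C(X, X))) :
    IsDihedralInduced (DihedralGroup.r 1 : DihedralGroup 0) (DihedralGroup.sr 0)
      (restrictCompEquiv φ Y hYφ) (extendByZero Y hY) (restrictToSet Y) where
  mul_self := DihedralGroup.sr_mul_self 0
  pow_eq_one k hk := by
    rw [DihedralGroup.r_one_pow, DihedralGroup.one_def, DihedralGroup.r.injEq] at hk
    exact (Nat.cast_eq_zero (R := ℤ)).1 hk
  exists_zpow g := by
    rcases g with i | i
    · exact Or.inl ⟨i, dihedralGroup_r_eq_zpow i⟩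
    · refine Or.inr ⟨i, Eq.trans ?_ (congrArg _ (dihedralGroup_r_eq_zpow i))⟩
      rw [DihedralGroup.sr_mul_r, zero_add]
  twist n := by
    rw [eq_inv_smul_iff, hr]
    ext x
    rw [ContinuousMap.comp_apply]
    by_cases hx : x ∈ Y
    · have hx' : φ.symm x ∈ Y := by rwa [← mem_iff_of_image_eq hYφ, φ.apply_symm_apply]
      refine (extendByZero_apply_mem hY _ ⟨_, hx'⟩).trans
        (Eq.trans ?_ (extendByZero_apply_mem hY n ⟨x, hx⟩).symm)
      exact congrArg n (Subtype.ext (φ.apply_symm_apply x))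
    · have hx' : φ.symm x ∉ Y := by rwa [← mem_iff_of_image_eq hYφ, φ.apply_symm_apply]
      exact (extendByZero_apply_notMem hY _ hx').trans (extendByZero_apply_notMem hY _ hx).symm
  proj_incl n := by
    ext y
    exact extendByZero_apply_mem hY n y
  proj_smul_incl n := by
    rw [hsr]
    ext y
    exact extendByZero_apply_notMem hY n ((mem_iff_apply_notMem hσ hYσ hYcov _).1 y.2)
  decomp f := by
    rw [hsr, hsr]
    ext x
    rw [ContinuousMap.add_apply, ContinuousMap.comp_apply]
    by_cases hx : x ∈ Y
    · rw [extendByZero_apply_mem hY _ ⟨x, hx⟩]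
      erw [extendByZero_apply_notMem hY _ ((mem_iff_apply_notMem hσ hYσ hYcov _).1 hx)]
      exact (add_zero _).symm
    · have hx' : σ x ∈ Y := not_not.1 (mt (mem_iff_apply_notMem hσ hYσ hYcov x).2 hx)
      rw [extendByZero_apply_notMem hY _ hx]
      erw [extendByZero_apply_mem hY _ ⟨σ x, hx'⟩]
      rw [zero_add]
      exact congrArg f (hσ x).symm

/-- A continuous function on `Y` invariant under `φ` is constant along an orbit. -/
lemma apply_zpow_eq {φ : X ≃ₜ X} {Y : Set X} (hYφ : φ '' Y = Y) {n : C(Y, ℤ)}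
    (hn : n.comp (restrictCMap φ Y hYφ) = n) (y : Y) (k : ℤ) :
    ∃ h : (φ.toEquiv ^ k) y.1 ∈ Y, n ⟨_, h⟩ = n y := by
  have hstep : ∀ (x x' : X) (hx : φ x = x'), (∃ h : x ∈ Y, n ⟨x, h⟩ = n y) ↔
      ∃ h : x' ∈ Y, n ⟨x', h⟩ = n y := by
    rintro x _ rfl
    constructor
    · rintro ⟨h, hx⟩
      exact ⟨(mem_iff_of_image_eq hYφ x).2 h, (DFunLike.congr_fun hn ⟨x, h⟩).trans hx⟩
    · rintro ⟨h, hx⟩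
      have h' := (mem_iff_of_image_eq hYφ x).1 h
      exact ⟨h', (DFunLike.congr_fun hn ⟨x, h'⟩).symm.trans hx⟩
  induction k using Int.induction_on with
  | zero => exact ⟨y.2, rfl⟩
  | succ k ih =>
    refine (hstep _ _ ?_).1 ih
    rw [add_comm, zpow_add, zpow_one]
    rfl
  | pred k ih =>
    refine (hstep _ _ ?_).2 ih
    have h := (zpow_one_add φ.toEquiv (-(k : ℤ) - 1)).symm
    rw [add_sub_cancel] at h
    exact DFunLike.congr_fun h y.1

/-- A continuous function on `Y` invariant under a minimal homeomorphism is constant. -/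
lemma apply_eq_of_comp_eq {φ : X ≃ₜ X} {Y : Set X} (hY : IsClopen Y) (hYφ : φ '' Y = Y)
    (hYmin : ∀ x ∈ Y, Y ⊆ closure (Set.range fun n : ℤ => (φ.toEquiv ^ n) x)) {n : C(Y, ℤ)}
    (hn : n.comp (restrictCMap φ Y hYφ) = n) (y z : Y) : n z = n y := by
  have hclosed : IsClosed (Subtype.val '' (n ⁻¹' {n y})) :=
    hY.isClosed.isClosedMap_subtype_val _ ((isClosed_discrete _).preimage n.continuous)
  have hsub : Set.range (fun k : ℤ => (φ.toEquiv ^ k) y.1) ⊆ Subtype.val '' (n ⁻¹' {n y}) := by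
    rintro _ ⟨k, rfl⟩
    obtain ⟨h, hk⟩ := apply_zpow_eq hYφ hn y k
    exact ⟨⟨_, h⟩, hk, rfl⟩
  obtain ⟨z', hz', h⟩ := hclosed.closure_subset_iff.2 hsub (hYmin y y.2 z.2)
  rwa [Subtype.ext h] at hz'

/-- The invariants of `C(Y, ℤ)` under a minimal homeomorphism are the constants. -/
theorem nonempty_invariants_equiv {φ : X ≃ₜ X} {Y : Set X} (hY : IsClopen Y) (hYφ : φ '' Y = Y)
    (hYmin : ∀ x ∈ Y, Y ⊆ closure (Set.range fun n : ℤ => (φ.toEquiv ^ n) x)) (y : Y) :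
    Nonempty (((restrictCompEquiv φ Y hYφ).toAddMonoidHom - AddMonoidHom.id _).ker ≃+ ℤ) := by
  refine ⟨AddEquiv.ofBijective (⟨⟨fun n => n.1 y, rfl⟩, fun _ _ => rfl⟩ :
    ((restrictCompEquiv φ Y hYφ).toAddMonoidHom - AddMonoidHom.id _).ker →+ ℤ) ⟨?_, ?_⟩⟩
  · intro n m hnm
    ext z
    exact (apply_eq_of_comp_eq hY hYφ hYmin (sub_eq_zero.1 n.2) y z).trans
      (Eq.trans hnm (apply_eq_of_comp_eq hY hYφ hYmin (sub_eq_zero.1 m.2) y z).symm)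
  · intro k
    exact ⟨⟨ContinuousMap.const Y k, sub_eq_zero.2 rfl⟩, rfl⟩

end DihedralSystem

/-- Homology of a Cantor minimal `ℤ ⋊ ℤ₂`-system `α = (φ, σ)` for which the `ℤ`-action
induced by `φ` is not minimal, where `Y` is a clopen set with `Y ∩ σ(Y) = ∅`,
`Y ∪ σ(Y) = X`, `φ(Y) = Y` and `φ|_Y` minimal (the infinite dihedral group being
`DihedralGroup 0`, acting on the module `C(X, ℤ)` with `r 1 • f = f ∘ φ⁻¹` and
`sr 0 • f = f ∘ σ`): `H₀ ≅ H₀(ℤ, C(Y, ℤ))` (the coinvariants of `C(Y, ℤ)` under `φ|_Y`),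
`H₁ ≅ ℤ`, and `Hₙ = 0` for every `n ≥ 2`. -/
theorem homology_of_dihedral_system_phi_not_minimal {X : Type*} [TopologicalSpace X]
    [CompactSpace X] [TopologicalSpace.MetrizableSpace X] [TotallyDisconnectedSpace X]
    [PerfectSpace X] [Nonempty X] (φ σ : X ≃ₜ X)
    (hσ : ∀ x, σ (σ x) = x) (hrel : ∀ x, σ (φ (σ x)) = φ.symm x)
    (hmin : ∀ x : X,
      Dense {y : X | ∃ (n : ℤ) (i : Bool), y = (φ.toEquiv ^ n) (cond i (σ x) x)})
    (hφnotmin : ∃ x : X, ¬ Dense (Set.range fun n : ℤ => (φ.toEquiv ^ n) x))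
    (Y : Set X) (hY : IsClopen Y) (hYσ : Y ∩ σ '' Y = ∅) (hYcov : Y ∪ σ '' Y = Set.univ)
    (hYφ : φ '' Y = Y)
    (hYmin : ∀ x ∈ Y, Y ⊆ closure (Set.range fun n : ℤ => (φ.toEquiv ^ n) x))
    [DistribMulAction (DihedralGroup 0) C(X, ℤ)]
    (hr : ∀ f : C(X, ℤ),
      (DihedralGroup.r 1 : DihedralGroup 0) • f = f.comp (φ.symm : C(X, X)))
    (hsr : ∀ f : C(X, ℤ),
      (DihedralGroup.sr 0 : DihedralGroup 0) • f = f.comp (σ : C(X, X))) :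
    Nonempty (GroupHomology (DihedralGroup 0) C(X, ℤ) 0 ≃+
      (C(Y, ℤ) ⧸ coboundariesSubgroup (restrictCMap φ Y hYφ))) ∧
    Nonempty (GroupHomology (DihedralGroup 0) C(X, ℤ) 1 ≃+ ℤ) ∧
    (∀ n : ℕ, 2 ≤ n → ∀ x : GroupHomology (DihedralGroup 0) C(X, ℤ) n, x = 0) := by
  have H := isDihedralInduced_of_clopen φ σ hσ Y hY hYσ hYcov hYφ hr hsr
  obtain ⟨y⟩ : Nonempty Y := by
    obtain ⟨x⟩ := ‹Nonempty X›
    by_cases hx : x ∈ Y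
    · exact ⟨⟨x, hx⟩⟩
    · exact ⟨⟨σ x, not_not.1 (mt (mem_iff_apply_notMem hσ hYσ hYcov x).2 hx)⟩⟩
  obtain ⟨e⟩ := H.nonempty_groupHomology_one_equiv
  obtain ⟨e'⟩ := nonempty_invariants_equiv hY hYφ hYmin y
  exact ⟨H.nonempty_groupHomology_zero_equiv (mem_coboundariesSubgroup_iff _), ⟨e.trans e'⟩,
    H.groupHomology_eq_zero⟩
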